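/- Consider polynomial functions of four spinors z₁, z₂, z₃, z₄ ∈ ℂ² (eight complex variables z_a^A, a ∈ {1,2,3,4}, A ∈ {0,1}). Define the differential operators E_ab := Σ_{A∈{0,1}} z_a^A · ∂/∂z_b^A and the invariant operator 4·J₁·J₂ := 2·E₁₂E₂₁ − E₁₁E₂₂ − 2·E₁₁. For a 6-tuple m = (m₁₂,m₁₃,m₁₄,m₂₃,m₂₄,m₃₄) of integers, define P_m(z) := ∏_{1≤i<j≤4} [z_i|z_j⟩^{m_ij}/(m_ij)! if all m_ij ≥ 0, and P_m := 0 otherwise. Then for all nonnegative integers k = (k₁₂,k₁₃,k₁₄,k₂₃,k₂₄,k₃₄), writing 2j₁ := k₁₂+k₁₃+k₁₄, 2j₂ := k₁₂+k₂₃+k₂₄, and 2S := k₁₃+k₁₄+k₂₃+k₂₄: 4·(J₁·J₂)P_k = 2·(S(S+1) − j₁(j₁+1) − j₂(j₂+1))·P_k + 2·( (k₁₃+1)(k₂₄+1)·P_{(k₁₂, k₁₃+1, k₁₄−1, k₂₃−1, k₂₄+1, k₃₄)} − k₁₃k₂₄·P_k ) + 2·( (k₁₄+1)(k₂₃+1)·P_{(k₁₂,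 k₁₃−1, k₁₄+1, k₂₃+1, k₂₄−1, k₃₄)} − k₁₄k₂₃·P_k ). (This is the action of the scalar-product operator J₁·J₂ on the discrete-coherent basis |S,T⟩: it preserves the label S, shifting only T by ±1.) -/

import Mathlib

/-!
STATEMENT 19: the action of the scalar-product operator J₁·J₂ (built from
the differential operators E_ab = Σ_A z_a^A ∂/∂z_b^A) on the
discrete-coherent basis: it preserves S, shifting only T by ±1.
-/

noncomputable section

/-- A configuration of four spinors. -/
abbrev Config := Fin 4 → Fin 2 → ℂ

/-- The holomorphic bracket `[z|w⟩ = z₀w₁ − z₁w₀`. -/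
def bra (z w : Fin 2 → ℂ) : ℂ := z 0 * w 1 - z 1 * w 0

/-- The differential operator `E_ab = Σ_A z_a^A ∂/∂z_b^A`. -/
def Eop (a b : Fin 4) (f : Config → ℂ) : Config → ℂ :=
  fun z => ∑ A : Fin 2, z a A * fderiv ℂ f z (Pi.single b (Pi.single A 1))

/-- `P_m = ∏_{i<j} [z_i|z_j⟩^{m_ij}/(m_ij)!` if all m_ij ≥ 0, and 0 otherwise. -/
def Pint (m12 m13 m14 m23 m24 m34 : ℤ) (z : Config) : ℂ :=
  if 0 ≤ m12 ∧ 0 ≤ m13 ∧ 0 ≤ m14 ∧ 0 ≤ m23 ∧ 0 ≤ m24 ∧ 0 ≤ m34 then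
    (bra (z 0) (z 1) ^ m12.toNat / (Nat.factorial m12.toNat : ℂ)) *
    (bra (z 0) (z 2) ^ m13.toNat / (Nat.factorial m13.toNat : ℂ)) *
    (bra (z 0) (z 3) ^ m14.toNat / (Nat.factorial m14.toNat : ℂ)) *
    (bra (z 1) (z 2) ^ m23.toNat / (Nat.factorial m23.toNat : ℂ)) *
    (bra (z 1) (z 3) ^ m24.toNat / (Nat.factorial m24.toNat : ℂ)) *
    (bra (z 2) (z 3) ^ m34.toNat / (Nat.factorial m34.toNat : ℂ))
  else 0

/-- The divided power `x ^ n / n!`, extended by zero to negative `n`. -/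
def dividedPow (n : ℤ) (x : ℂ) : ℂ :=
  if 0 ≤ n then x ^ n.toNat / (Nat.factorial n.toNat : ℂ) else 0

theorem hasDerivAt_dividedPow (n : ℤ) (x : ℂ) :
    HasDerivAt (dividedPow n) (dividedPow (n - 1) x) x := by
  rcases lt_or_ge n 0 with h | h
  · have h0 : dividedPow n = fun _ => 0 := by
      funext y
      simp [dividedPow, not_le.mpr h]
    have h1 : ¬ 0 ≤ n - 1 := by omega
    rw [h0, dividedPow, if_neg h1]
    exact hasDerivAt_const x 0
  · lift n to ℕ using h
    cases n with
    | zero =>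
      have h0 : dividedPow ((0 : ℕ) : ℤ) = fun _ => 1 := by
        funext y
        simp [dividedPow]
      rw [h0]
      simpa [dividedPow] using hasDerivAt_const x (1 : ℂ)
    | succ n =>
      have h0 : dividedPow ((n + 1 : ℕ) : ℤ) =
          fun y => y ^ (n + 1) / (Nat.factorial (n + 1) : ℂ) := by
        funext y
        rw [dividedPow, if_pos (by positivity), Int.toNat_natCast]
      have h1 : ((n + 1 : ℕ) : ℤ) - 1 = n := by push_cast; ring
      rw [h0, h1, dividedPow, if_pos (by positivity), Int.toNat_natCast]
      refine ((hasDerivAt_pow (n + 1) x).div_const (Nat.factorial (n + 1) : ℂ)).congr_deriv ?_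
      have : (Nat.factorial n : ℂ) ≠ 0 := by exact_mod_cast n.factorial_ne_zero
      have : (n : ℂ) + 1 ≠ 0 := by exact_mod_cast n.succ_ne_zero
      rw [Nat.factorial_succ]
      push_cast
      field_simp

theorem mul_dividedPow (n : ℤ) (x : ℂ) :
    x * dividedPow n x = (n + 1) * dividedPow (n + 1) x := by
  rcases lt_or_ge n 0 with h | h
  · rcases eq_or_ne n (-1) with rfl | h'
    · simp [dividedPow]
    · have h1 : ¬ 0 ≤ n + 1 := by omega
      simp [dividedPow, not_le.mpr h, h1]
  · lift n to ℕ using h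
    have h1 : ((n : ℤ) + 1) = ((n + 1 : ℕ) : ℤ) := by push_cast; ring
    rw [h1, dividedPow, dividedPow, if_pos (by positivity), if_pos (by positivity),
      Int.toNat_natCast, Int.toNat_natCast, Nat.factorial_succ]
    have : (Nat.factorial n : ℂ) ≠ 0 := by exact_mod_cast n.factorial_ne_zero
    have : (n : ℂ) + 1 ≠ 0 := by exact_mod_cast n.succ_ne_zero
    push_cast
    field_simp
    ring

theorem mul_dividedPow_sub_one (n : ℤ) (x : ℂ) :
    x * dividedPow (n - 1) x = n * dividedPow n x := by
  simpa using mul_dividedPow (n - 1) x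

theorem Pint_eq_prod_dividedPow (m12 m13 m14 m23 m24 m34 : ℤ) :
    Pint m12 m13 m14 m23 m24 m34 = fun z =>
      dividedPow m12 (bra (z 0) (z 1)) * dividedPow m13 (bra (z 0) (z 2)) *
      dividedPow m14 (bra (z 0) (z 3)) * dividedPow m23 (bra (z 1) (z 2)) *
      dividedPow m24 (bra (z 1) (z 3)) * dividedPow m34 (bra (z 2) (z 3)) := by
  funext z
  by_cases h : 0 ≤ m12 ∧ 0 ≤ m13 ∧ 0 ≤ m14 ∧ 0 ≤ m23 ∧ 0 ≤ m24 ∧ 0 ≤ m34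
  · simp only [Pint, dividedPow, h, and_self, if_true]
  · rw [Pint, if_neg h]
    simp only [not_and_or] at h
    rcases h with h | h | h | h | h | h <;> simp only [dividedPow, if_neg h, mul_zero, zero_mul]

theorem differentiableAt_bra (i j : Fin 4) (z : Config) :
    DifferentiableAt ℂ (fun z : Config => bra (z i) (z j)) z := by
  unfold bra
  fun_prop

theorem fderiv_bra_apply (i j : Fin 4) (z v : Config) :
    fderiv ℂ (fun z : Config => bra (z i) (z j)) z v
      = bra (v i) (z j) + bra (z i) (v j) := by
  have h (i : Fin 4) (A : Fin 2) : HasFDerivAt (fun z : Config => z i A)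
      ((ContinuousLinearMap.proj (R := ℂ) (φ := fun _ : Fin 2 => ℂ) A).comp
        (ContinuousLinearMap.proj (R := ℂ) (φ := fun _ : Fin 4 => Fin 2 → ℂ) i)) z :=
    ((ContinuousLinearMap.proj (R := ℂ) (φ := fun _ : Fin 2 => ℂ) A).comp
      (ContinuousLinearMap.proj (R := ℂ) (φ := fun _ : Fin 4 => Fin 2 → ℂ) i)).hasFDerivAt
  have := ((h i 0).mul (h j 1)).sub ((h i 1).mul (h j 0))
  have h2 : HasFDerivAt (fun z : Config => bra (z i) (z j)) _ z := this
  rw [h2.fderiv]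
  simp [bra]
  ring

theorem hasFDerivAt_dividedPow_bra (n : ℤ) (i j : Fin 4) (z : Config) :
    HasFDerivAt (fun z : Config => dividedPow n (bra (z i) (z j)))
      (dividedPow (n - 1) (bra (z i) (z j)) •
        fderiv ℂ (fun z : Config => bra (z i) (z j)) z) z :=
  (hasDerivAt_dividedPow n _).comp_hasFDerivAt z (differentiableAt_bra i j z).hasFDerivAt

theorem differentiable_Pint (m12 m13 m14 m23 m24 m34 : ℤ) :
    Differentiable ℂ (Pint m12 m13 m14 m23 m24 m34) := by
  have h (n : ℤ) (i j : Fin 4) :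
      Differentiable ℂ (fun z : Config => dividedPow n (bra (z i) (z j))) :=
    fun z => (hasFDerivAt_dividedPow_bra n i j z).differentiableAt
  rw [Pint_eq_prod_dividedPow]
  exact (((((h m12 0 1).mul (h m13 0 2)).mul (h m14 0 3)).mul (h m23 1 2)).mul
    (h m24 1 3)).mul (h m34 2 3)

theorem fderiv_Pint_apply (m12 m13 m14 m23 m24 m34 : ℤ) (z v : Config) :
    fderiv ℂ (Pint m12 m13 m14 m23 m24 m34) z v =
      (bra (v 0) (z 1) + bra (z 0) (v 1)) * Pint (m12 - 1) m13 m14 m23 m24 m34 z +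
      (bra (v 0) (z 2) + bra (z 0) (v 2)) * Pint m12 (m13 - 1) m14 m23 m24 m34 z +
      (bra (v 0) (z 3) + bra (z 0) (v 3)) * Pint m12 m13 (m14 - 1) m23 m24 m34 z +
      (bra (v 1) (z 2) + bra (z 1) (v 2)) * Pint m12 m13 m14 (m23 - 1) m24 m34 z +
      (bra (v 1) (z 3) + bra (z 1) (v 3)) * Pint m12 m13 m14 m23 (m24 - 1) m34 z +
      (bra (v 2) (z 3) + bra (z 2) (v 3)) * Pint m12 m13 m14 m23 m24 (m34 - 1) z := by
  have h := ((((((hasFDerivAt_dividedPow_bra m12 0 1 z).mul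
    (hasFDerivAt_dividedPow_bra m13 0 2 z)).mul
    (hasFDerivAt_dividedPow_bra m14 0 3 z)).mul
    (hasFDerivAt_dividedPow_bra m23 1 2 z)).mul
    (hasFDerivAt_dividedPow_bra m24 1 3 z)).mul
    (hasFDerivAt_dividedPow_bra m34 2 3 z))
  conv_lhs => rw [Pint_eq_prod_dividedPow]
  refine (DFunLike.congr_fun (HasFDerivAt.fderiv h) v).trans ?_
  simp only [add_apply, smul_apply, smul_eq_mul, fderiv_bra_apply,
    Pint_eq_prod_dividedPow, Pi.mul_apply]
  ring

theorem Eop_apply (a b : Fin 4) (f : Config → ℂ) (z : Config) :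
    Eop a b f z = fderiv ℂ f z (Pi.single b (z a)) := by
  have h : (Pi.single b (z a) : Config) =
      ∑ A : Fin 2, z a A • (Pi.single b (Pi.single A 1) : Config) := by
    ext i A
    by_cases hi : i = b
    · subst hi
      fin_cases A <;> simp
    · simp [hi]
  rw [h, map_sum]
  simp [Eop]

theorem Eop_const_mul (a b : Fin 4) (c : ℂ) {f : Config → ℂ} (hf : Differentiable ℂ f)
    (z : Config) : Eop a b (fun z => c * f z) z = c * Eop a b f z := by
  simp [Eop_apply, fderiv_const_mul (hf z)]

theorem Eop_add (a b : Fin 4) {f g : Config → ℂ} (hf : Differentiable ℂ f)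
    (hg : Differentiable ℂ g) (z : Config) :
    Eop a b (fun z => f z + g z) z = Eop a b f z + Eop a b g z := by
  simp [Eop_apply, fderiv_fun_add (hf z) (hg z)]

theorem bra_self (z : Fin 2 → ℂ) : bra z z = 0 := by
  simp [bra, mul_comm]

theorem bra_zero_left (z : Fin 2 → ℂ) : bra 0 z = 0 := by
  simp [bra]

theorem bra_zero_right (z : Fin 2 → ℂ) : bra z 0 = 0 := by
  simp [bra]

section Eop_Pint

variable (m12 m13 m14 m23 m24 m34 : ℤ)

theorem Eop_zero_zero_Pint (z : Config) :
    Eop 0 0 (Pint m12 m13 m14 m23 m24 m34) z =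
      ((m12 : ℂ) + m13 + m14) * Pint m12 m13 m14 m23 m24 m34 z := by
  have h12 := mul_dividedPow_sub_one m12 (bra (z 0) (z 1))
  have h13 := mul_dividedPow_sub_one m13 (bra (z 0) (z 2))
  have h14 := mul_dividedPow_sub_one m14 (bra (z 0) (z 3))
  rw [Eop_apply, fderiv_Pint_apply]
  simp [bra_zero_left, bra_zero_right, Pint_eq_prod_dividedPow]
  grind

theorem Eop_one_one_Pint :
    Eop 1 1 (Pint m12 m13 m14 m23 m24 m34) = fun z =>
      ((m12 : ℂ) + m23 + m24) * Pint m12 m13 m14 m23 m24 m34 z := by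
  funext z
  have h12 := mul_dividedPow_sub_one m12 (bra (z 0) (z 1))
  have h23 := mul_dividedPow_sub_one m23 (bra (z 1) (z 2))
  have h24 := mul_dividedPow_sub_one m24 (bra (z 1) (z 3))
  rw [Eop_apply, fderiv_Pint_apply]
  simp [bra_zero_left, bra_zero_right, Pint_eq_prod_dividedPow]
  grind

theorem Eop_one_zero_Pint :
    Eop 1 0 (Pint m12 m13 m14 m23 m24 m34) = fun z =>
      ((m23 : ℂ) + 1) * Pint m12 (m13 - 1) m14 (m23 + 1) m24 m34 z +
      ((m24 : ℂ) + 1) * Pint m12 m13 (m14 - 1) m23 (m24 + 1) m34 z := by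
  funext z
  have h23 := mul_dividedPow m23 (bra (z 1) (z 2))
  have h24 := mul_dividedPow m24 (bra (z 1) (z 3))
  rw [Eop_apply, fderiv_Pint_apply]
  simp [bra_self, bra_zero_left, bra_zero_right, Pint_eq_prod_dividedPow]
  grind

theorem Eop_zero_one_Pint (z : Config) :
    Eop 0 1 (Pint m12 m13 m14 m23 m24 m34) z =
      ((m13 : ℂ) + 1) * Pint m12 (m13 + 1) m14 (m23 - 1) m24 m34 z +
      ((m14 : ℂ) + 1) * Pint m12 m13 (m14 + 1) m23 (m24 - 1) m34 z := by
  have h13 := mul_dividedPow m13 (bra (z 0) (z 2))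
  have h14 := mul_dividedPow m14 (bra (z 0) (z 3))
  rw [Eop_apply, fderiv_Pint_apply]
  simp [bra_self, bra_zero_left, bra_zero_right, Pint_eq_prod_dividedPow]
  grind

end Eop_Pint

theorem J1J2_on_discrete_coherent_basis
    (k12 k13 k14 k23 k24 k34 : ℕ) (z : Config) :
    2 * Eop 0 1 (Eop 1 0 (Pint k12 k13 k14 k23 k24 k34)) z
      - Eop 0 0 (Eop 1 1 (Pint k12 k13 k14 k23 k24 k34)) z
      - 2 * Eop 0 0 (Pint k12 k13 k14 k23 k24 k34) z
    = (2 * ((((k13 : ℂ) + k14 + k23 + k24) / 2) * ((((k13 : ℂ) + k14 + k23 + k24) / 2) + 1)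
          - (((k12 : ℂ) + k13 + k14) / 2) * ((((k12 : ℂ) + k13 + k14) / 2) + 1)
          - (((k12 : ℂ) + k23 + k24) / 2) * ((((k12 : ℂ) + k23 + k24) / 2) + 1)))
        * Pint k12 k13 k14 k23 k24 k34 z
      + 2 * (((k13 : ℂ) + 1) * ((k24 : ℂ) + 1)
            * Pint k12 ((k13 : ℤ) + 1) ((k14 : ℤ) - 1) ((k23 : ℤ) - 1) ((k24 : ℤ) + 1) k34 z
          - (k13 : ℂ) * (k24 : ℂ) * Pint k12 k13 k14 k23 k24 k34 z)
      + 2 * (((k14 : ℂ) + 1) * ((k23 : ℂ) + 1)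
            * Pint k12 ((k13 : ℤ) - 1) ((k14 : ℤ) + 1) ((k23 : ℤ) + 1) ((k24 : ℤ) - 1) k34 z
          - (k14 : ℂ) * (k23 : ℂ) * Pint k12 k13 k14 k23 k24 k34 z) := by
  rw [Eop_one_zero_Pint, Eop_one_one_Pint, Eop_zero_zero_Pint,
    Eop_add _ _ ((differentiable_Pint _ _ _ _ _ _).const_mul _)
      ((differentiable_Pint _ _ _ _ _ _).const_mul _),
    Eop_const_mul _ _ _ (differentiable_Pint _ _ _ _ _ _),
    Eop_const_mul _ _ _ (differentiable_Pint _ _ _ _ _ _),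
    Eop_const_mul _ _ _ (differentiable_Pint _ _ _ _ _ _),
    Eop_zero_one_Pint, Eop_zero_one_Pint, Eop_zero_zero_Pint]
  simp only [sub_add_cancel, add_sub_cancel_right]
  push_cast
  ring
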